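/- arXiv:math-ph/9904034 — 2 statements merged into one kernel-verified Lean document; each statement's English description precedes it below -/
import Mathlib

section
/- Let l₁, l₂, l₃ be nonzero real numbers, c₁, c₂, c₃ nonzero real numbers, and κ₁, κ₂, κ₃ real numbers. Define u : ℝ × ℝ³ → ℂ by u(t,x) = exp( Σ_{i=1}^3 ( −(κ_i²/(2 l_i c_i²))·e^{−2 l_i t} − l_i t ) ) · exp( i·Σ_{i=1}^3 κ_i x_i e^{−l_i t}/c_i ). Then for all (t,x) ∈ ℝ × ℝ³, ∂_t u + Σ_{a=1}^3 ∂²_{x_a} u + Σ_{a=1}^3 ∂_{x_a}( l_a x_a · u ) = 0. -/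
open Real Complex

/-- Spatial partial derivative `∂f/∂x_a` of a complex-valued function on `ℝ × ℝ³`. -/
noncomputable def pdx (a : Fin 3) (f : ℝ × (Fin 3 → ℝ) → ℂ)
    (p : ℝ × (Fin 3 → ℝ)) : ℂ :=
  deriv (fun s => f (p.1, Function.update p.2 a s)) (p.2 a)

/-- Time partial derivative `∂f/∂t` of a complex-valued function on `ℝ × ℝ³`. -/
noncomputable def pdt (f : ℝ × (Fin 3 → ℝ) → ℂ) (p : ℝ × (Fin 3 → ℝ)) : ℂ :=
  deriv (fun s => f (s, p.2)) p.1

/-- The separated solution in Cartesian coordinates (solution 1 of the paper). -/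
noncomputable def uCart (l c κ : Fin 3 → ℝ) (p : ℝ × (Fin 3 → ℝ)) : ℂ :=
  Complex.exp ((∑ i : Fin 3,
      (-(κ i) ^ 2 / (2 * l i * (c i) ^ 2) * Real.exp (-2 * l i * p.1) - l i * p.1) : ℝ))
    * Complex.exp (Complex.I *
      ((∑ i : Fin 3, κ i * p.2 i * Real.exp (-(l i) * p.1) / c i : ℝ)))

theorem aux_x (l c κ : Fin 3 → ℝ) (t : ℝ) (x : Fin 3 → ℝ) (a : Fin 3) (s : ℝ) :
    HasDerivAt (fun s : ℝ => uCart l c κ (t, Function.update x a s))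
      (Complex.I * ((κ a * Real.exp (-(l a) * t) / c a : ℝ) : ℂ)
        * uCart l c κ (t, Function.update x a s)) s := by
  have h1 : HasDerivAt (fun s : ℝ => ∑ i : Fin 3,
      κ i * (Function.update x a s) i * Real.exp (-(l i) * t) / c i)
      (∑ i : Fin 3, κ i * (Pi.single a (1 : ℝ) : Fin 3 → ℝ) i * Real.exp (-(l i) * t) / c i) s := by
    apply HasDerivAt.fun_sum
    intro i _
    have := (hasDerivAt_pi.1 (hasDerivAt_update x a s)) i
    exact ((this.const_mul (κ i)).mul_const _).div_const _
  have h2 : (∑ i : Fin 3, κ i * (Pi.single a (1 : ℝ) : Fin 3 → ℝ) i * Real.exp (-(l i) * t) / c i)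
      = κ a * Real.exp (-(l a) * t) / c a := by
    rw [Finset.sum_eq_single a]
    · simp
    · intro b _ hb
      simp [hb]
    · simp
  rw [h2] at h1
  have h3 := ((h1.ofReal_comp.const_mul Complex.I).cexp).const_mul
    (Complex.exp ((∑ i : Fin 3,
      (-(κ i) ^ 2 / (2 * l i * (c i) ^ 2) * Real.exp (-2 * l i * t) - l i * t) : ℝ)))
  refine h3.congr_deriv ?_
  simp only [uCart]
  ring

theorem aux_t (l c κ : Fin 3 → ℝ) (hl : ∀ i, l i ≠ 0) (hc : ∀ i, c i ≠ 0)
    (x : Fin 3 → ℝ) (t : ℝ) :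
    HasDerivAt (fun t : ℝ => uCart l c κ (t, x))
      ((((∑ i : Fin 3, ((κ i * Real.exp (-(l i) * t) / c i) ^ 2 - l i) : ℝ) : ℂ)
        + Complex.I * ((∑ i : Fin 3, -(l i * x i * (κ i * Real.exp (-(l i) * t) / c i)) : ℝ) : ℂ))
        * uCart l c κ (t, x)) t := by
  have h1 : HasDerivAt (fun t : ℝ => ∑ i : Fin 3,
      (-(κ i) ^ 2 / (2 * l i * (c i) ^ 2) * Real.exp (-2 * l i * t) - l i * t))
      (∑ i : Fin 3, ((κ i * Real.exp (-(l i) * t) / c i) ^ 2 - l i)) t := by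
    apply HasDerivAt.fun_sum
    intro i _
    have e : Real.exp (-2 * l i * t) = Real.exp (-(l i) * t) ^ 2 := by
      rw [← Real.exp_nat_mul]; congr 1; push_cast; ring
    have := ((((hasDerivAt_id t).const_mul (-2 * l i)).exp).const_mul
      (-(κ i) ^ 2 / (2 * l i * (c i) ^ 2))).sub ((hasDerivAt_id t).const_mul (l i))
    refine this.congr_deriv ?_
    simp only [id]
    rw [e]
    have := hl i
    have := hc i
    field_simp
  have h2 : HasDerivAt (fun t : ℝ => ∑ i : Fin 3, κ i * x i * Real.exp (-(l i) * t) / c i)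
      (∑ i : Fin 3, -(l i * x i * (κ i * Real.exp (-(l i) * t) / c i))) t := by
    apply HasDerivAt.fun_sum
    intro i _
    have := ((((hasDerivAt_id t).const_mul (-(l i))).exp).const_mul (κ i * x i)).div_const (c i)
    refine this.congr_deriv ?_
    simp only [id]
    ring
  have h3 := (h1.ofReal_comp.cexp).mul ((h2.ofReal_comp.const_mul Complex.I).cexp)
  refine h3.congr_deriv ?_
  simp only [uCart]
  ring

theorem aux_pdx (l c κ : Fin 3 → ℝ) (a : Fin 3) :
    pdx a (uCart l c κ) = fun q =>
      Complex.I * ((κ a * Real.exp (-(l a) * q.1) / c a : ℝ) : ℂ) * uCart l c κ q := by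
  funext q
  unfold pdx
  rw [(aux_x l c κ q.1 q.2 a (q.2 a)).deriv, Function.update_eq_self]

/-- the Cartesian separated solution solves the Fokker–Planck
equation with linear drift `B x = (l₁x₁, l₂x₂, l₃x₃)`. -/
theorem stmt_10 (l c κ : Fin 3 → ℝ) (hl : ∀ i, l i ≠ 0) (hc : ∀ i, c i ≠ 0) :
    ∀ p : ℝ × (Fin 3 → ℝ),
      pdt (uCart l c κ) p
      + (∑ a : Fin 3, pdx a (pdx a (uCart l c κ)) p)
      + (∑ a : Fin 3, pdx a (fun q => ((l a * q.2 a : ℝ) : ℂ) * uCart l c κ q) p)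
      = 0 := by
  intro p
  obtain ⟨t, x⟩ := p
  have ht : pdt (uCart l c κ) (t, x) = _ := (aux_t l c κ hl hc x t).deriv
  have hxx : ∀ a, pdx a (pdx a (uCart l c κ)) (t, x)
      = -((κ a * Real.exp (-(l a) * t) / c a : ℝ) : ℂ) ^ 2 * uCart l c κ (t, x) := by
    intro a
    rw [aux_pdx]
    unfold pdx
    have := (aux_x l c κ t x a (x a)).const_mul
      (Complex.I * ((κ a * Real.exp (-(l a) * t) / c a : ℝ) : ℂ))
    refine this.deriv.trans ?_
    rw [Function.update_eq_self]
    linear_combination (((κ a * Real.exp (-(l a) * t) / c a : ℝ) : ℂ) ^ 2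
      * uCart l c κ (t, x)) * Complex.I_mul_I
  have hd : ∀ a, pdx a (fun q => ((l a * q.2 a : ℝ) : ℂ) * uCart l c κ q) (t, x)
      = ((l a : ℂ) + Complex.I * (l a * x a * ((κ a * Real.exp (-(l a) * t) / c a : ℝ) : ℂ)))
        * uCart l c κ (t, x) := by
    intro a
    unfold pdx
    simp only [Function.update_self]
    have := (((hasDerivAt_id (x a)).const_mul (l a)).ofReal_comp).mul (aux_x l c κ t x a (x a))
    refine this.deriv.trans ?_
    rw [Function.update_eq_self]
    simp only [id]
    push_cast
    ring
  rw [ht]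
  simp only [hxx, hd, Fin.sum_univ_three]
  push_cast
  ring
end

section
/- Let B₃ : (0,∞) → ℝ be continuous, let λ, k ∈ ℝ, let m be an integer, and let ψ : (0,∞) → ℂ be twice differentiable and satisfy ψ''(ρ) + ψ'(ρ)/ρ + ( k² + k·B₃(ρ) − λ − m²/ρ² )·ψ(ρ) = 0 for all ρ > 0. Define u : ℝ × D → ℂ on D = {x ∈ ℝ³ : x₁ > 0} by u(t,x) = e^{−λt}·e^{k x₃}·e^{i m·arctan(x₂/x₁)}·ψ(√(x₁²+x₂²)). Then u satisfies ∂_t u + Σ_{a=1}^3 ∂²_{x_a} u + ∂_{x₃}( B₃(√(x₁²+x₂²))·u ) = 0 at every point of ℝ × D. -/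
open Real Complex

/-- The cylindrically separated Ansatz
`u(t,x) = e^{-λt} e^{k x₃} e^{i m arctan(x₂/x₁)} ψ(√(x₁²+x₂²))`. -/
noncomputable def uCyl (lam k : ℝ) (m : ℤ) (ψ : ℝ → ℂ)
    (p : ℝ × (Fin 3 → ℝ)) : ℂ :=
  Complex.exp ((-(lam * p.1) : ℝ)) * Complex.exp ((k * p.2 2 : ℝ))
    * Complex.exp (Complex.I * (m : ℂ) * (Real.arctan (p.2 1 / p.2 0) : ℂ))
    * ψ (Real.sqrt ((p.2 0) ^ 2 + (p.2 1) ^ 2))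

lemma pdx_pdx (a : Fin 3) (f : ℝ × (Fin 3 → ℝ) → ℂ) (p : ℝ × (Fin 3 → ℝ)) :
    pdx a (pdx a f) p
      = deriv (deriv (fun r => f (p.1, Function.update p.2 a r))) (p.2 a) := by
  simp [pdx, Function.update_idem]

lemma first_aux (C c : ℂ) (ψ : ℝ → ℂ) (θ ρ : ℝ → ℝ) (s a b : ℝ)
    (h1 : HasDerivAt θ a s) (h2 : HasDerivAt ρ b s) (h : DifferentiableAt ℝ ψ (ρ s)) :
    HasDerivAt (fun r => C * Complex.exp (c * (θ r : ℂ)) * ψ (ρ r))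
      (C * Complex.exp (c * (θ s : ℂ)) * (c * a * ψ (ρ s) + b * deriv ψ (ρ s))) s := by
  have e1 : HasDerivAt (fun r => C * Complex.exp (c * (θ r : ℂ)))
      (C * (Complex.exp (c * (θ s : ℂ)) * (c * a))) s :=
    ((h1.ofReal_comp.const_mul c).cexp).const_mul C
  have e2 : HasDerivAt (fun r => ψ (ρ r)) (b • deriv ψ (ρ s)) s :=
    h.hasDerivAt.scomp s h2
  refine (e1.mul e2).congr_deriv ?_
  simp only [Complex.real_smul]
  ring

lemma second_aux (C c : ℂ) (ψ : ℝ → ℂ) (θ ρ θ' ρ' : ℝ → ℝ) (s a b : ℝ)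
    (hψ : ∀ ρ : ℝ, 0 < ρ → DifferentiableAt ℝ ψ ρ)
    (hψ' : ∀ ρ : ℝ, 0 < ρ → DifferentiableAt ℝ (deriv ψ) ρ)
    (h1 : ∀ᶠ r in nhds s, HasDerivAt θ (θ' r) r ∧ HasDerivAt ρ (ρ' r) r ∧ 0 < ρ r)
    (h2 : HasDerivAt θ' a s) (h3 : HasDerivAt ρ' b s) :
    deriv (deriv (fun r => C * Complex.exp (c * (θ r : ℂ)) * ψ (ρ r))) s
      = C * Complex.exp (c * (θ s : ℂ)) *
        ((c ^ 2 * θ' s ^ 2 + c * a) * ψ (ρ s) + (2 * c * θ' s * ρ' s + b) * deriv ψ (ρ s)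
          + ρ' s ^ 2 * deriv (deriv ψ) (ρ s)) := by
  have e : deriv (fun r => C * Complex.exp (c * (θ r : ℂ)) * ψ (ρ r)) =ᶠ[nhds s]
      fun r => (c * (θ' r : ℂ)) * (C * Complex.exp (c * (θ r : ℂ)) * ψ (ρ r))
        + (ρ' r : ℂ) * (C * Complex.exp (c * (θ r : ℂ)) * deriv ψ (ρ r)) := by
    filter_upwards [h1] with r hr
    rw [(first_aux C c ψ θ ρ r _ _ hr.1 hr.2.1 (hψ _ hr.2.2)).deriv]
    ring
  rw [e.deriv_eq]
  obtain ⟨g1, g2, g3⟩ := h1.self_of_nhds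
  have k1 := first_aux C c ψ θ ρ s _ _ g1 g2 (hψ _ g3)
  have k2 := first_aux C c (deriv ψ) θ ρ s _ _ g1 g2 (hψ' _ g3)
  have := ((h2.ofReal_comp.const_mul c).mul k1).add (h3.ofReal_comp.mul k2)
  refine (HasDerivAt.deriv this).trans ?_
  ring

lemma rad_aux (x y : ℝ) (hx : 0 < x) :
    HasDerivAt (fun r => Real.sqrt (r ^ 2 + y ^ 2)) (x / Real.sqrt (x ^ 2 + y ^ 2)) x := by
  have hp : 0 < x ^ 2 + y ^ 2 := by positivity
  have := (((hasDerivAt_pow 2 x).add_const (y ^ 2))).sqrt hp.ne'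
  refine this.congr_deriv ?_
  have : Real.sqrt (x ^ 2 + y ^ 2) ≠ 0 := (Real.sqrt_pos.2 hp).ne'
  field_simp
  simp [mul_comm]

lemma rad_aux' (x y : ℝ) (hx : 0 < x) :
    HasDerivAt (fun r => Real.sqrt (x ^ 2 + r ^ 2)) (y / Real.sqrt (x ^ 2 + y ^ 2)) y := by
  have hp : 0 < x ^ 2 + y ^ 2 := by positivity
  have := (((hasDerivAt_pow 2 y).const_add (x ^ 2))).sqrt hp.ne'
  refine this.congr_deriv ?_
  have : Real.sqrt (x ^ 2 + y ^ 2) ≠ 0 := (Real.sqrt_pos.2 hp).ne'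
  field_simp
  simp [mul_comm]

lemma ang_aux (x y : ℝ) (hx : 0 < x) :
    HasDerivAt (fun r => Real.arctan (y / r)) (-y / (x ^ 2 + y ^ 2)) x := by
  have hp : 0 < x ^ 2 + y ^ 2 := by positivity
  have := ((hasDerivAt_const x y).div (hasDerivAt_id x) hx.ne').arctan
  refine this.congr_deriv ?_
  simp only [Pi.div_apply, id]
  field_simp
  ring

lemma ang_aux' (x y : ℝ) (hx : 0 < x) :
    HasDerivAt (fun r => Real.arctan (r / x)) (x / (x ^ 2 + y ^ 2)) y := by
  have hp : 0 < x ^ 2 + y ^ 2 := by positivity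
  have := ((hasDerivAt_id y).div_const x).arctan
  refine this.congr_deriv ?_
  simp only [id]
  field_simp

lemma xx_aux (C c : ℂ) (ψ : ℝ → ℂ) (x y : ℝ) (hx : 0 < x)
    (hψ : ∀ ρ : ℝ, 0 < ρ → DifferentiableAt ℝ ψ ρ)
    (hψ' : ∀ ρ : ℝ, 0 < ρ → DifferentiableAt ℝ (deriv ψ) ρ) (R : ℝ)
    (hR : R = Real.sqrt (x ^ 2 + y ^ 2)) :
    deriv (deriv (fun r => C * Complex.exp (c * (Real.arctan (y / r) : ℂ))
        * ψ (Real.sqrt (r ^ 2 + y ^ 2)))) x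
      = C * Complex.exp (c * (Real.arctan (y / x) : ℂ)) *
        ((c ^ 2 * ((-y / R ^ 2 : ℝ) : ℂ) ^ 2 + c * ((2 * x * y / R ^ 4 : ℝ) : ℂ)) * ψ R
          + (2 * c * ((-y / R ^ 2 : ℝ) : ℂ) * ((x / R : ℝ) : ℂ)
            + ((y ^ 2 / R ^ 3 : ℝ) : ℂ)) * deriv ψ R
          + ((x / R : ℝ) : ℂ) ^ 2 * deriv (deriv ψ) R) := by
  have hp : 0 < x ^ 2 + y ^ 2 := by positivity
  have hR2 : R ^ 2 = x ^ 2 + y ^ 2 := by rw [hR, Real.sq_sqrt hp.le]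
  have hR0 : 0 < R := by rw [hR]; exact Real.sqrt_pos.2 hp
  have h := second_aux C c ψ (fun r => Real.arctan (y / r)) (fun r => Real.sqrt (r ^ 2 + y ^ 2))
    (fun r => -y / (r ^ 2 + y ^ 2)) (fun r => r / Real.sqrt (r ^ 2 + y ^ 2)) x
    (2 * x * y / R ^ 4) (y ^ 2 / R ^ 3) hψ hψ' ?_ ?_ ?_
  · simp only [← hR] at h
    simp only [← hR2] at h
    exact h
  · filter_upwards [lt_mem_nhds hx] with r hr
    exact ⟨ang_aux r y hr, rad_aux r y hr, Real.sqrt_pos.2 (by positivity)⟩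
  · have := (hasDerivAt_const x (-y)).div ((hasDerivAt_pow 2 x).add_const (y ^ 2)) hp.ne'
    refine this.congr_deriv ?_
    rw [← hR2]
    field_simp
    simp
  · have := (hasDerivAt_id x).div (rad_aux x y hx) (by rw [← hR]; exact hR0.ne')
    refine this.congr_deriv ?_
    rw [← hR]
    simp only [id]
    field_simp
    linarith

lemma yy_aux (C c : ℂ) (ψ : ℝ → ℂ) (x y : ℝ) (hx : 0 < x)
    (hψ : ∀ ρ : ℝ, 0 < ρ → DifferentiableAt ℝ ψ ρ)
    (hψ' : ∀ ρ : ℝ, 0 < ρ → DifferentiableAt ℝ (deriv ψ) ρ) (R : ℝ)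
    (hR : R = Real.sqrt (x ^ 2 + y ^ 2)) :
    deriv (deriv (fun r => C * Complex.exp (c * (Real.arctan (r / x) : ℂ))
        * ψ (Real.sqrt (x ^ 2 + r ^ 2)))) y
      = C * Complex.exp (c * (Real.arctan (y / x) : ℂ)) *
        ((c ^ 2 * ((x / R ^ 2 : ℝ) : ℂ) ^ 2 + c * ((-2 * x * y / R ^ 4 : ℝ) : ℂ)) * ψ R
          + (2 * c * ((x / R ^ 2 : ℝ) : ℂ) * ((y / R : ℝ) : ℂ)
            + ((x ^ 2 / R ^ 3 : ℝ) : ℂ)) * deriv ψ R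
          + ((y / R : ℝ) : ℂ) ^ 2 * deriv (deriv ψ) R) := by
  have hp : 0 < x ^ 2 + y ^ 2 := by positivity
  have hR2 : R ^ 2 = x ^ 2 + y ^ 2 := by rw [hR, Real.sq_sqrt hp.le]
  have hR0 : 0 < R := by rw [hR]; exact Real.sqrt_pos.2 hp
  have h := second_aux C c ψ (fun r => Real.arctan (r / x)) (fun r => Real.sqrt (x ^ 2 + r ^ 2))
    (fun r => x / (x ^ 2 + r ^ 2)) (fun r => r / Real.sqrt (x ^ 2 + r ^ 2)) y
    (-2 * x * y / R ^ 4) (x ^ 2 / R ^ 3) hψ hψ' ?_ ?_ ?_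
  · simp only [← hR] at h
    simp only [← hR2] at h
    exact h
  · exact Filter.Eventually.of_forall fun r =>
      ⟨ang_aux' x r hx, rad_aux' x r hx, Real.sqrt_pos.2 (by positivity)⟩
  · have := (hasDerivAt_const y x).div ((hasDerivAt_pow 2 y).const_add (x ^ 2)) hp.ne'
    refine this.congr_deriv ?_
    rw [← hR2]
    field_simp
    simp
  · have := (hasDerivAt_id y).div (rad_aux' x y hx) (by rw [← hR]; exact hR0.ne')
    refine this.congr_deriv ?_
    rw [← hR]
    simp only [id]
    field_simp
    linarith

lemma exp_aux (A D : ℂ) (k z : ℝ) :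
    HasDerivAt (fun s : ℝ => A * Complex.exp ((k * s : ℝ) : ℂ) * D)
      (k * (A * Complex.exp ((k * z : ℝ) : ℂ) * D)) z := by
  have h : HasDerivAt (fun s : ℝ => k * s) k z := by
    simpa using (hasDerivAt_id z).const_mul k
  refine (((h.ofReal_comp.cexp).const_mul A).mul_const D).congr_deriv ?_
  ring

/-- if `ψ` solves the radial ODE
`ψ'' + ψ'/ρ + (k² + k B₃(ρ) − λ − m²/ρ²) ψ = 0` on `(0,∞)`, then the
cylindrically separated Ansatz `uCyl` solves the Fokker–Planck equation with
(non-linear) drift `B = (0, 0, B₃(√(x₁²+x₂²)))` on `ℝ × {x : x₁ > 0}`. -/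
theorem stmt_17 (B₃ : ℝ → ℝ) (hB₃ : ContinuousOn B₃ (Set.Ioi 0))
    (lam k : ℝ) (m : ℤ) (ψ : ℝ → ℂ)
    (hψ : ∀ ρ : ℝ, 0 < ρ → DifferentiableAt ℝ ψ ρ)
    (hψ' : ∀ ρ : ℝ, 0 < ρ → DifferentiableAt ℝ (deriv ψ) ρ)
    (hode : ∀ ρ : ℝ, 0 < ρ →
      deriv (deriv ψ) ρ + deriv ψ ρ / (ρ : ℂ)
        + ((k ^ 2 + k * B₃ ρ - lam - (m : ℝ) ^ 2 / ρ ^ 2 : ℝ) : ℂ) * ψ ρ = 0) :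
    ∀ p : ℝ × (Fin 3 → ℝ), 0 < p.2 0 →
      pdt (uCyl lam k m ψ) p
      + (∑ a : Fin 3, pdx a (pdx a (uCyl lam k m ψ)) p)
      + pdx 2 (fun q =>
          ((B₃ (Real.sqrt ((q.2 0) ^ 2 + (q.2 1) ^ 2)) : ℝ) : ℂ)
            * uCyl lam k m ψ q) p
      = 0 := by
  rintro ⟨t, v⟩ hx
  simp only at hx
  obtain ⟨x, hxv⟩ : ∃ x, x = v 0 := ⟨_, rfl⟩
  obtain ⟨y, hyv⟩ : ∃ y, y = v 1 := ⟨_, rfl⟩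
  obtain ⟨z, hzv⟩ : ∃ z, z = v 2 := ⟨_, rfl⟩
  rw [← hxv] at hx
  have hp : 0 < x ^ 2 + y ^ 2 := by positivity
  obtain ⟨R, hR⟩ : ∃ R, R = Real.sqrt (x ^ 2 + y ^ 2) := ⟨_, rfl⟩
  have hR2 : R ^ 2 = x ^ 2 + y ^ 2 := by rw [hR, Real.sq_sqrt hp.le]
  have hR0 : 0 < R := by rw [hR]; exact Real.sqrt_pos.2 hp
  obtain ⟨U, hU⟩ : ∃ U : ℂ, U = Complex.exp ((-(lam * t) : ℝ)) * Complex.exp ((k * z : ℝ))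
    * Complex.exp (Complex.I * (m : ℂ) * (Real.arctan (y / x) : ℂ)) := ⟨_, rfl⟩
  have ht : pdt (uCyl lam k m ψ) (t, v) = -lam * (U * ψ R) := by
    have h := (exp_aux 1 (Complex.exp ((k * z : ℝ))
      * Complex.exp (Complex.I * (m : ℂ) * (Real.arctan (y / x) : ℂ)) * ψ R) (-lam) t).deriv
    simp only [pdt, uCyl, ← hxv, ← hyv, ← hzv, ← hR]
    rw [hU]
    convert h using 1
    · congr 1
      funext s
      rw [neg_mul]
      ring
    · rw [neg_mul lam t]
      push_cast
      ring
  have hz : ∀ w : ℝ, pdx 2 (fun q => (w : ℂ) * uCyl lam k m ψ q) (t, v) = w * (k * (U * ψ R)) := by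
    intro w
    have h := (exp_aux (w * Complex.exp ((-(lam * t) : ℝ)))
      (Complex.exp (Complex.I * (m : ℂ) * (Real.arctan (y / x) : ℂ)) * ψ R) k z).deriv
    simp only [pdx, uCyl, Function.update_self, ne_eq, Fin.reduceEq, not_false_eq_true,
      Function.update_of_ne, ← hxv, ← hyv, ← hzv, ← hR]
    rw [hU]
    convert h using 1
    · congr 1
      funext s
      ring
    · ring
  have hB : pdx 2 (fun q =>
          ((B₃ (Real.sqrt ((q.2 0) ^ 2 + (q.2 1) ^ 2)) : ℝ) : ℂ)
            * uCyl lam k m ψ q) (t, v) = B₃ R * (k * (U * ψ R)) := by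
    rw [← hz]
    simp only [pdx, ne_eq, Fin.reduceEq, not_false_eq_true,
      Function.update_of_ne, ← hxv, ← hyv, ← hR]
  have hzz : pdx 2 (pdx 2 (uCyl lam k m ψ)) (t, v) = k ^ 2 * (U * ψ R) := by
    rw [pdx_pdx]
    have h1 := fun s => (exp_aux (Complex.exp ((-(lam * t) : ℝ)))
      (Complex.exp (Complex.I * (m : ℂ) * (Real.arctan (y / x) : ℂ)) * ψ R) k s)
    simp only [uCyl, Function.update_self, ne_eq, Fin.reduceEq, not_false_eq_true,
      Function.update_of_ne, ← hxv, ← hyv, ← hzv, ← hR]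
    simp only [← mul_assoc] at h1
    rw [show deriv _ = _ from funext fun s => (h1 s).deriv]
    have h2 := ((h1 z).const_mul (k : ℂ)).deriv
    simp only [← mul_assoc] at h2
    rw [h2, hU]
    ring
  have hxx : pdx 0 (pdx 0 (uCyl lam k m ψ)) (t, v) =
      deriv (deriv (fun r : ℝ => Complex.exp ((-(lam * t) : ℝ)) * Complex.exp ((k * z : ℝ))
        * Complex.exp (Complex.I * (m : ℂ) * (Real.arctan (y / r) : ℂ))
        * ψ (Real.sqrt (r ^ 2 + y ^ 2)))) x := by
    rw [pdx_pdx]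
    simp only [uCyl, Function.update_self, ne_eq, Fin.reduceEq, not_false_eq_true,
      Function.update_of_ne, ← hxv, ← hyv, ← hzv]
  rw [xx_aux _ _ ψ x y hx hψ hψ' R hR, ← hU] at hxx
  have hyy : pdx 1 (pdx 1 (uCyl lam k m ψ)) (t, v) =
      deriv (deriv (fun r : ℝ => Complex.exp ((-(lam * t) : ℝ)) * Complex.exp ((k * z : ℝ))
        * Complex.exp (Complex.I * (m : ℂ) * (Real.arctan (r / x) : ℂ))
        * ψ (Real.sqrt (x ^ 2 + r ^ 2)))) y := by
    rw [pdx_pdx]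
    simp only [uCyl, Function.update_self, ne_eq, Fin.reduceEq, not_false_eq_true,
      Function.update_of_ne, ← hxv, ← hyv, ← hzv]
  rw [yy_aux _ _ ψ x y hx hψ hψ' R hR, ← hU] at hyy
  rw [Fin.sum_univ_three, ht, hB, hxx, hyy, hzz]
  have ho := hode R hR0
  have hRc : (R : ℂ) ≠ 0 := by exact_mod_cast hR0.ne'
  have hR2c : (R : ℂ) ^ 2 = x ^ 2 + y ^ 2 := by exact_mod_cast hR2
  have hy2 : (y : ℂ) ^ 2 = R ^ 2 - x ^ 2 := by rw [hR2c]; ring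
  have hI : Complex.I ^ 2 = -1 := Complex.I_sq
  have hdd : deriv (deriv ψ) R = -(deriv ψ R / (R : ℂ)
        + ((k ^ 2 + k * B₃ R - lam - (m : ℝ) ^ 2 / R ^ 2 : ℝ) : ℂ) * ψ R) := by
    linear_combination ho
  rw [hdd]
  push_cast
  simp only [mul_pow, div_pow, neg_sq, hI, hy2]
  field_simp
  ring
end
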